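/- Let U ⊆ ℝ² be an open connected set, f = (f₁, f₂) : U → ℝ² a C² map with det Df(z) ≠ 0 for every z ∈ U, and z₀ ∈ U a point with f(z₀) = (0,0). Then the following are equivalent: (1) the center z₀ of ∇H_f^⊥ is global, i.e., every point z ∈ U \ {z₀} lies on a periodic solution of ∇H_f^⊥ whose image is contained in U; (2) f is injective on U and moreover f(U) = ℝ² or f(U) is an open disc centered at the origin (f(U) = {w ∈ ℝ² : ‖w‖ < r} for some r > 0). -/

import Mathlib

open Real Set

/-- Partial derivative in the `x` direction. -/
noncomputable def pdx (g : ℝ × ℝ → ℝ) (z : ℝ × ℝ) : ℝ := fderiv ℝ g z (1, 0)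

/-- Partial derivative in the `y` direction. -/
noncomputable def pdy (g : ℝ × ℝ → ℝ) (z : ℝ × ℝ) : ℝ := fderiv ℝ g z (0, 1)

/-- The Hamiltonian `H_f = (f₁² + f₂²)/2`. -/
noncomputable def Ham (f : ℝ × ℝ → ℝ × ℝ) (z : ℝ × ℝ) : ℝ :=
  ((f z).1 ^ 2 + (f z).2 ^ 2) / 2

/-- The Hamiltonian vector field `∇H_f^⊥ = (−∂H_f/∂y, ∂H_f/∂x)`. -/
noncomputable def hamVF (f : ℝ × ℝ → ℝ × ℝ) (z : ℝ × ℝ) : ℝ × ℝ :=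
  (-(pdy (Ham f) z), pdx (Ham f) z)

/-- The Jacobian determinant `det Df = ∂f₁/∂x ∂f₂/∂y − ∂f₂/∂x ∂f₁/∂y`. -/
noncomputable def jacDet (f : ℝ × ℝ → ℝ × ℝ) (z : ℝ × ℝ) : ℝ :=
  pdx (fun w => (f w).1) z * pdy (fun w => (f w).2) z -
    pdx (fun w => (f w).2) z * pdy (fun w => (f w).1) z

/-- `γ` is a periodic solution of the vector field `X` whose image is contained in `S`:
a non-constant `C¹` curve solving `γ' = X ∘ γ` with some period `T > 0`. -/
def IsPeriodicSolOn (X : ℝ × ℝ → ℝ × ℝ) (S : Set (ℝ × ℝ)) (γ : ℝ → ℝ × ℝ) : Prop :=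
  (∀ t, γ t ∈ S) ∧ (∀ t, HasDerivAt γ (X (γ t)) t) ∧
    (∃ T > 0, ∀ t, γ (t + T) = γ t) ∧ ∃ t s, γ t ≠ γ s

/-- The Euclidean norm on `ℝ²`. -/
noncomputable def euclNorm (w : ℝ × ℝ) : ℝ := Real.sqrt (w.1 ^ 2 + w.2 ^ 2)

/-- The open Euclidean disc of radius `r` centered at the origin. -/
def disc (r : ℝ) : Set (ℝ × ℝ) := {w | euclNorm w < r}

/-- `W` is the period annulus of the singular point `z₀` of the vector field `X` on `U`:
the maximal open connected subset of `U` containing `z₀` all whose points other than `z₀`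
lie on periodic solutions of `X` contained in `W`. -/
def IsPeriodAnnulus (X : ℝ × ℝ → ℝ × ℝ) (U : Set (ℝ × ℝ)) (z₀ : ℝ × ℝ)
    (W : Set (ℝ × ℝ)) : Prop :=
  z₀ ∈ W ∧ W ⊆ U ∧ IsOpen W ∧ IsConnected W ∧
    (∀ z ∈ W \ {z₀}, ∃ γ, IsPeriodicSolOn X W γ ∧ γ 0 = z) ∧
    ∀ W', z₀ ∈ W' → W' ⊆ U → IsOpen W' → IsConnected W' →
      (∀ z ∈ W' \ {z₀}, ∃ γ, IsPeriodicSolOn X W' γ ∧ γ 0 = z) → W ⊆ W' → W' = W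

open Topology Metric

section Topological

variable {X E : Type*} [TopologicalSpace X] [NormedAddCommGroup E]
  {F : X → E}

/-- An open set `W` is a sheet over a ball when `F` maps it bijectively onto a ball centered at
the origin. -/
def IsBallSheet (F : X → E) (x₀ : X) (r : ℝ) (W : Set X) : Prop :=
  IsOpen W ∧ x₀ ∈ W ∧ InjOn F W ∧ F '' W = ball 0 r

theorem IsBallSheet.isPreconnected [NormedSpace ℝ E] (hF : IsOpenMap F) {x₀ : X} {r : ℝ}
    {W : Set X} (h : IsBallSheet F x₀ r W) : IsPreconnected W := by
  obtain ⟨hW, -, hinj, him⟩ := h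
  have hpre : IsPreconnected ((W.domRestrict F) ⁻¹' (ball (0 : E) r)) := by
    refine (convex_ball (0 : E) r).isPreconnected.preimage_of_isOpenMap
      (injOn_iff_injective.1 hinj) (hF.comp hW.isOpenMap_subtype_val) ?_
    rw [range_domRestrict, him]
  have := hpre.image Subtype.val continuous_subtype_val.continuousOn
  convert this using 1
  ext z
  constructor
  · intro hz
    exact ⟨⟨z, hz⟩, him ▸ mem_image_of_mem F hz, rfl⟩
  · rintro ⟨z, -, rfl⟩
    exact z.2

theorem exists_isBallSheet (hF : IsLocalHomeomorph F) {x₀ : X} (h0 : F x₀ = 0) :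
    ∃ r > 0, ∃ W, IsBallSheet F x₀ r W := by
  obtain ⟨φ, hx, rfl⟩ := hF x₀
  have h0' : (0 : E) ∈ φ.target := h0 ▸ φ.map_source hx
  obtain ⟨r, hr, hball⟩ := Metric.isOpen_iff.1 φ.open_target 0 h0'
  refine ⟨r, hr, φ.source ∩ φ ⁻¹' ball 0 r, φ.isOpen_inter_preimage isOpen_ball, ⟨hx, ?_⟩,
    φ.injOn.mono inter_subset_left, ?_⟩
  · simp [h0, hr]
  · ext w
    constructor
    · rintro ⟨z, hz, rfl⟩
      exact hz.2
    · intro hw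
      exact ⟨φ.symm w, ⟨φ.map_target (hball hw), by
        rw [mem_preimage, φ.right_inv (hball hw)]; exact hw⟩, φ.right_inv (hball hw)⟩

variable [T2Space X]

/-- If an open map is injective on an open set `W`, then a limit point of `W` whose image is
already attained on `W` lies in `W`. -/
theorem mem_of_mem_closure_of_injOn (hF : IsOpenMap F) (hFc : Continuous F) {W : Set X}
    (hW : IsOpen W) (hinj : InjOn F W) {p : X} (hp : p ∈ closure W) (hFp : F p ∈ F '' W) :
    p ∈ W := by
  obtain ⟨q, hq, hqp⟩ := hFp
  by_contra hpW
  have hne : p ≠ q := fun h => hpW (h ▸ hq)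
  obtain ⟨u, v, hu, hv, hpu, hqv, huv⟩ := t2_separation hne
  have hopen : IsOpen (u ∩ F ⁻¹' (F '' (v ∩ W))) :=
    hu.inter ((hF _ (hv.inter hW)).preimage hFc)
  obtain ⟨z, ⟨hzu, y, ⟨hyv, hyW⟩, hyz⟩, hzW⟩ :=
    mem_closure_iff.1 hp _ hopen ⟨hpu, ⟨q, ⟨hqv, hq⟩, hqp⟩⟩
  have : y = z := hinj hyW hzW hyz
  subst this
  exact huv.le_bot ⟨hzu, hyv⟩

theorem IsBallSheet.subset [NormedSpace ℝ E] (hF : IsLocalHomeomorph F) {x₀ : X} {r r' : ℝ}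
    {W W' : Set X} (h : IsBallSheet F x₀ r W) (h' : IsBallSheet F x₀ r' W') (hr : r ≤ r') :
    W ⊆ W' := by
  refine (h.isPreconnected hF.isOpenMap).subset_of_closure_inter_subset h'.1
    ⟨x₀, h.2.1, h'.2.1⟩ ?_
  rintro p ⟨hp, hpW⟩
  refine mem_of_mem_closure_of_injOn hF.isOpenMap hF.continuous h'.1 h'.2.2.1 hp ?_
  rw [h'.2.2.2]
  exact ball_subset_ball hr (h.2.2.2 ▸ mem_image_of_mem F hpW)

/-- At a point of the closure of a sheet over `ball 0 R`, a local inverse maps the part of a small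
ball contained in `ball 0 R` into the sheet. -/
theorem IsBallSheet.local_inverse_mem [NormedSpace ℝ E] (hF : IsLocalHomeomorph F) {x₀ : X}
    {R : ℝ} {V : Set X} (h : IsBallSheet F x₀ R V) (φ : OpenPartialHomeomorph X E)
    (hφ : F = φ) {q : X} (hq : q ∈ closure V) (hqs : q ∈ φ.source) {δ : ℝ} (hδ : 0 < δ)
    (hball : ball (F q) δ ⊆ φ.target) {w : E} (hw : w ∈ ball (F q) δ) (hwR : w ∈ ball 0 R) :
    φ.symm w ∈ V := by
  have hC : IsPreconnected (φ.symm '' (ball (F q) δ ∩ ball 0 R)) :=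
    ((convex_ball _ _).inter (convex_ball _ _)).isPreconnected.image _
      (φ.continuousOn_symm.mono (inter_subset_left.trans hball))
  refine hC.subset_of_closure_inter_subset h.1 ?_ ?_ ⟨w, ⟨hw, hwR⟩, rfl⟩
  · obtain ⟨z, ⟨hzs, hzb⟩, hzV⟩ := mem_closure_iff.1 hq (φ.source ∩ F ⁻¹' ball (F q) δ)
      (φ.open_source.inter (isOpen_ball.preimage hF.continuous)) ⟨hqs, mem_ball_self hδ⟩
    refine ⟨z, ⟨F z, ⟨hzb, h.2.2.2 ▸ mem_image_of_mem F hzV⟩, ?_⟩, hzV⟩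
    rw [hφ, φ.left_inv hzs]
  · rintro _ ⟨hp, w', ⟨hw'b, hw'R⟩, rfl⟩
    refine mem_of_mem_closure_of_injOn hF.isOpenMap hF.continuous h.1 h.2.2.1 hp ?_
    rw [h.2.2.2, hφ, φ.right_inv (hball hw'b)]
    exact hw'R

theorem IsBallSheet.local_inverse_apply [NormedSpace ℝ E] (hF : IsLocalHomeomorph F) {x₀ : X}
    {R : ℝ} {V : Set X} (h : IsBallSheet F x₀ R V) (φ : OpenPartialHomeomorph X E)
    (hφ : F = φ) {q : X} (hq : q ∈ closure V) (hqs : q ∈ φ.source) {δ : ℝ} (hδ : 0 < δ)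
    (hball : ball (F q) δ ⊆ φ.target) {z : X} (hz : z ∈ closure V) (hzb : F z ∈ ball (F q) δ) :
    φ.symm (F z) = z := by
  have hV : ∀ y ∈ V, F y ∈ ball (F q) δ → φ.symm (F y) = y := by
    intro y hy hyb
    have hyR : F y ∈ ball (0 : E) R := h.2.2.2 ▸ mem_image_of_mem F hy
    refine h.2.2.1 (h.local_inverse_mem hF φ hφ hq hqs hδ hball hyb hyR) hy ?_
    rw [hφ, φ.right_inv (hball (hφ ▸ hyb))]
  by_contra hne
  obtain ⟨u, v, hu, hv, hpu, hqv, huv⟩ := t2_separation hne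
  have hcont : ContinuousAt (fun y => φ.symm (F y)) z :=
    (φ.continuousAt_symm (hball hzb)).comp (f := F) hF.continuous.continuousAt
  have hmem : (fun y => φ.symm (F y)) ⁻¹' u ∩ (v ∩ F ⁻¹' ball (F q) δ) ∈ 𝓝 z :=
    Filter.inter_mem (hcont (hu.mem_nhds hpu)) (Filter.inter_mem (hv.mem_nhds hqv)
      ((isOpen_ball.preimage hF.continuous).mem_nhds hzb))
  obtain ⟨y, ⟨hyu, hyv, hyb⟩, hyV⟩ := mem_closure_iff_nhds.1 hz _ hmem
  rw [mem_preimage, hV y hyV hyb] at hyu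
  exact huv.le_bot ⟨hyu, hyv⟩

theorem IsBallSheet.injOn_closure [NormedSpace ℝ E] (hF : IsLocalHomeomorph F) {x₀ : X}
    {R : ℝ} {V : Set X} (h : IsBallSheet F x₀ R V) : InjOn F (closure V) := by
  intro z hz q hq hzq
  obtain ⟨φ, hqs, hφ⟩ := hF q
  obtain ⟨δ, hδ, hball⟩ := Metric.isOpen_iff.1 φ.open_target (F q) (hφ ▸ φ.map_source hqs)
  have h1 := h.local_inverse_apply hF φ hφ hq hqs hδ hball hz (hzq ▸ mem_ball_self hδ)
  have h2 := h.local_inverse_apply hF φ hφ hq hqs hδ hball hq (mem_ball_self hδ)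
  rw [← h1, hzq, h2]

theorem IsBallSheet.isCompact_closure [NormedSpace ℝ E] [ProperSpace E]
    (hF : IsLocalHomeomorph F) {x₀ : X} {R : ℝ} {V : Set X} (h : IsBallSheet F x₀ R V)
    (him : closedBall 0 R ⊆ F '' closure V) : IsCompact (closure V) := by
  have hsub : F '' closure V ⊆ closedBall 0 R :=
    (image_closure_subset_closure_image hF.continuous).trans
      (h.2.2.2 ▸ closure_ball_subset_closedBall)
  rw [isCompact_iff_ultrafilter_le_nhds]
  intro 𝒰 h𝒰
  have hle : (𝒰.map F : Filter E) ≤ Filter.principal (closedBall (0 : E) R) := by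
    rw [Ultrafilter.coe_map]
    exact (Filter.map_mono h𝒰).trans (by rw [Filter.map_principal]; exact Filter.principal_mono.2 hsub)
  obtain ⟨w, hw, hlim⟩ := isCompact_iff_ultrafilter_le_nhds.1 (isCompact_closedBall (0 : E) R) _ hle
  obtain ⟨q, hq, rfl⟩ := him hw
  refine ⟨q, hq, ?_⟩
  obtain ⟨φ, hqs, hφ⟩ := hF q
  have htar : F q ∈ φ.target := hφ ▸ φ.map_source hqs
  obtain ⟨δ, hδ, hball⟩ := Metric.isOpen_iff.1 φ.open_target (F q) htar
  have htend : Filter.Tendsto F 𝒰 (𝓝 (F q)) := hlim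
  have h2 : Filter.Tendsto (fun z => φ.symm (F z)) 𝒰 (𝓝 q) := by
    have := (φ.continuousAt_symm htar).tendsto.comp htend
    rwa [h.local_inverse_apply hF φ hφ hq hqs hδ hball hq (mem_ball_self hδ)] at this
  have h3 : (fun z => φ.symm (F z)) =ᶠ[𝒰] id := by
    filter_upwards [htend (ball_mem_nhds _ hδ), h𝒰 (Filter.mem_principal_self _)] with z hz hzV
    exact h.local_inverse_apply hF φ hφ hq hqs hδ hball hzV hz
  exact (Filter.tendsto_congr' h3).1 h2

/-- A curve over the boundary sphere which starts in the closure of a sheet stays there. -/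
theorem IsBallSheet.curve_mem_closure [NormedSpace ℝ E] (hF : IsLocalHomeomorph F) {x₀ : X}
    {R : ℝ} (hR : 0 < R) {V : Set X} (h : IsBallSheet F x₀ R V) {γ : ℝ → X}
    (hγ : Continuous γ) (hnorm : ∀ t, ‖F (γ t)‖ = R) (h0 : γ 0 ∈ closure V) (t : ℝ) :
    γ t ∈ closure V := by
  have hclosed : IsClosed (γ ⁻¹' closure V) := isClosed_closure.preimage hγ
  have hopen : IsOpen (γ ⁻¹' closure V) := by
    rw [isOpen_iff_mem_nhds]
    intro t ht
    obtain ⟨φ, hqs, hφ⟩ := hF (γ t)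
    obtain ⟨δ, hδ, hball⟩ := Metric.isOpen_iff.1 φ.open_target (F (γ t)) (hφ ▸ φ.map_source hqs)
    have hnhd : φ.source ∩ F ⁻¹' ball (F (γ t)) δ ∈ 𝓝 (γ t) :=
      (φ.open_source.inter (isOpen_ball.preimage hF.continuous)).mem_nhds ⟨hqs, mem_ball_self hδ⟩
    filter_upwards [hγ.continuousAt hnhd] with s hs
    have hsR : F (γ s) ∈ closure (ball (0 : E) R) := by
      rw [closure_ball _ hR.ne']; simp [hnorm s]
    have hscl : F (γ s) ∈ closure (ball (F (γ t)) δ ∩ ball 0 R) :=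
      isOpen_ball.inter_closure ⟨hs.2, hsR⟩
    have := mem_closure_image (φ.continuousAt_symm (hball hs.2)) hscl
    have hmem : φ.symm (F (γ s)) ∈ closure V := by
      refine closure_mono ?_ this
      rintro _ ⟨w, ⟨hw, hwR⟩, rfl⟩
      exact h.local_inverse_mem hF φ hφ ht hqs hδ hball hw hwR
    rw [hφ, φ.left_inv hs.1] at hmem
    exact hmem
  have huniv := IsClopen.eq_univ ⟨hclosed, hopen⟩ ⟨0, h0⟩
  exact eq_univ_iff_forall.1 huniv t

/-- A sheet over `ball 0 R` whose closure covers `closedBall 0 R` extends to a larger sheet. -/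
theorem IsBallSheet.exists_larger [NormedSpace ℝ E] [ProperSpace E]
    (hF : IsLocalHomeomorph F) {x₀ : X} {R : ℝ} (hR : 0 < R) {V : Set X}
    (h : IsBallSheet F x₀ R V) (him : closedBall 0 R ⊆ F '' closure V) :
    ∃ r > R, ∃ W, IsBallSheet F x₀ r W := by
  have hloc : ∀ x ∈ closure V, ∃ u ∈ 𝓝 x, InjOn F u := by
    intro x _
    obtain ⟨φ, hxs, hφ⟩ := hF x
    exact ⟨φ.source, φ.open_source.mem_nhds hxs, hφ ▸ φ.injOn⟩
  obtain ⟨N', hN', hinj'⟩ := (h.injOn_closure hF).exists_mem_nhdsSet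
    (h.isCompact_closure hF him) (fun x _ => hF.continuous.continuousAt) hloc
  obtain ⟨N, hNo, hVN, hNN⟩ := mem_nhdsSet_iff_exists.1 hN'
  obtain ⟨ε, hε, hsub⟩ := (isCompact_closedBall (0 : E) R).exists_thickening_subset_open
    (hF.isOpenMap N hNo) (him.trans (image_mono hVN))
  rw [thickening_closedBall hε hR.le] at hsub
  refine ⟨ε + R, by linarith, N ∩ F ⁻¹' ball 0 (ε + R),
    hNo.inter (isOpen_ball.preimage hF.continuous), ⟨hVN (subset_closure h.2.1), ?_⟩,
    hinj'.mono (inter_subset_left.trans hNN), ?_⟩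
  · have : F x₀ ∈ ball (0 : E) R := h.2.2.2 ▸ mem_image_of_mem F h.2.1
    exact ball_subset_ball (by linarith) this
  · rw [image_inter_preimage]
    exact inter_eq_self_of_subset_right hsub

/-- A local homeomorphism from a connected space to a proper normed space is injective, with image
a ball or the whole space, when every sphere through a value `F p` lifts to a curve through `p`. -/
theorem injective_and_range_of_sphere_lift [NormedSpace ℝ E] [ProperSpace E] [ConnectedSpace X]
    (hF : IsLocalHomeomorph F) {x₀ : X} (h0 : F x₀ = 0)
    (hlift : ∀ p, F p ≠ 0 → ∃ γ : ℝ → X, Continuous γ ∧ γ 0 = p ∧ (∀ t, ‖F (γ t)‖ = ‖F p‖) ∧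
      ∀ w, ‖w‖ = ‖F p‖ → ∃ t, F (γ t) = w) :
    Function.Injective F ∧ (range F = univ ∨ ∃ r > 0, range F = ball 0 r) := by
  set S : Set ℝ := {r | 0 < r ∧ ∃ W, IsBallSheet F x₀ r W} with hS
  set V : Set X := {z | ∃ r > 0, ∃ W, IsBallSheet F x₀ r W ∧ z ∈ W} with hVdef
  have hVW : ∀ {r W}, 0 < r → IsBallSheet F x₀ r W → W ⊆ V :=
    fun hr hW z hz => ⟨_, hr, _, hW, hz⟩
  have hVo : IsOpen V := by
    rw [isOpen_iff_mem_nhds]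
    rintro z ⟨r, hr, W, hW, hz⟩
    exact Filter.mem_of_superset (hW.1.mem_nhds hz) (hVW hr hW)
  obtain ⟨r₀, hr₀, W₀, hW₀⟩ := exists_isBallSheet hF h0
  have hx₀ : x₀ ∈ V := hVW hr₀ hW₀ hW₀.2.1
  have hinj : InjOn F V := by
    rintro z ⟨r, hr, W, hW, hz⟩ z' ⟨r', hr', W', hW', hz'⟩ hzz
    rcases le_total r r' with hle | hle
    · exact hW'.2.2.1 (hW.subset hF hW' hle hz) hz' hzz
    · exact hW.2.2.1 hz (hW'.subset hF hW hle hz') hzz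
  have himage : ∀ w, w ∈ F '' V ↔ ∃ r ∈ S, ‖w‖ < r := by
    intro w
    constructor
    · rintro ⟨z, ⟨r, hr, W, hW, hz⟩, rfl⟩
      refine ⟨r, ⟨hr, W, hW⟩, ?_⟩
      have : F z ∈ ball (0 : E) r := hW.2.2.2 ▸ mem_image_of_mem F hz
      simpa using this
    · rintro ⟨r, ⟨hr, W, hW⟩, hwr⟩
      have : w ∈ F '' W := by rw [hW.2.2.2]; simpa using hwr
      exact image_mono (hVW hr hW) this
  have hVuniv : V = univ := by
    by_contra hne
    have hncl : ¬ IsClosed V := fun hcl => hne (IsClopen.eq_univ ⟨hcl, hVo⟩ ⟨x₀, hx₀⟩)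
    obtain ⟨p, hp, hpV⟩ : ∃ p, p ∈ closure V ∧ p ∉ V := by
      by_contra! hall
      exact hncl (closure_subset_iff_isClosed.1 hall)
    have hFp : F p ∉ F '' V := fun hmem =>
      hpV (mem_of_mem_closure_of_injOn hF.isOpenMap hF.continuous hVo hinj hp hmem)
    have hle : ∀ r ∈ S, r ≤ ‖F p‖ := by
      intro r hr
      by_contra! hlt
      exact hFp ((himage _).2 ⟨r, hr, hlt⟩)
    have hR : 0 < ‖F p‖ := hr₀.trans_le (hle r₀ ⟨hr₀, W₀, hW₀⟩)
    have hsheet : IsBallSheet F x₀ ‖F p‖ V := by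
      refine ⟨hVo, hx₀, hinj, ?_⟩
      ext w
      rw [himage, mem_ball_zero_iff]
      constructor
      · rintro ⟨r, hr, hwr⟩
        exact hwr.trans_le (hle r hr)
      · intro hw
        obtain ⟨z, hz, r, hr, W, hW, hzW⟩ := mem_closure_iff.1 hp {z | ‖w‖ < ‖F z‖}
          (isOpen_lt continuous_const hF.continuous.norm) hw
        have : F z ∈ ball (0 : E) r := hW.2.2.2 ▸ mem_image_of_mem F hzW
        exact ⟨r, ⟨hr, W, hW⟩, lt_trans hz (by simpa using this)⟩
    obtain ⟨γ, hγ, hγ0, hnorm, hsurj⟩ := hlift p (norm_pos_iff.1 hR)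
    have hcl : closedBall 0 ‖F p‖ ⊆ F '' closure V := by
      intro w hw
      rcases (mem_closedBall_zero_iff.1 hw).lt_or_eq with hlt | heq
      · exact image_mono subset_closure (hsheet.2.2.2 ▸ mem_ball_zero_iff.2 hlt)
      · obtain ⟨t, ht⟩ := hsurj w heq
        exact ⟨γ t, hsheet.curve_mem_closure hF hR hγ hnorm (hγ0 ▸ hp) t, ht⟩
    obtain ⟨r, hr, W, hW⟩ := hsheet.exists_larger hF hR hcl
    exact absurd (hle r ⟨hR.trans hr, W, hW⟩) (not_le.2 hr)
  refine ⟨injOn_univ.1 (hVuniv ▸ hinj), ?_⟩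
  have hrange : ∀ w, w ∈ range F ↔ ∃ r ∈ S, ‖w‖ < r := by
    rw [← image_univ, ← hVuniv]
    exact himage
  by_cases hbdd : BddAbove S
  · have hr₀S : r₀ ∈ S := ⟨hr₀, W₀, hW₀⟩
    refine Or.inr ⟨sSup S, hr₀.trans_le (le_csSup hbdd hr₀S), ?_⟩
    ext w
    rw [hrange, mem_ball_zero_iff, lt_csSup_iff hbdd ⟨r₀, hr₀S⟩]
  · refine Or.inl (eq_univ_of_forall fun w => (hrange w).2 ?_)
    exact not_bddAbove_iff.1 hbdd ‖w‖

end Topological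

section Jacobian

variable {f : ℝ × ℝ → ℝ × ℝ} {z : ℝ × ℝ}

theorem fderiv_apply_eq (L : ℝ × ℝ →L[ℝ] ℝ × ℝ) (v : ℝ × ℝ) :
    L v = v.1 • L (1, 0) + v.2 • L (0, 1) := by
  rw [← map_smul, ← map_smul, ← map_add]
  congr 1
  ext <;> simp

theorem jacDet_eq (hf : DifferentiableAt ℝ f z) :
    jacDet f z = (fderiv ℝ f z (1, 0)).1 * (fderiv ℝ f z (0, 1)).2 -
      (fderiv ℝ f z (1, 0)).2 * (fderiv ℝ f z (0, 1)).1 := by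
  simp only [jacDet, pdx, pdy, fderiv.fst hf, fderiv.snd hf]
  rfl

theorem fderiv_Ham_apply (hf : DifferentiableAt ℝ f z) (v : ℝ × ℝ) :
    fderiv ℝ (Ham f) z v = (f z).1 * (fderiv ℝ f z v).1 + (f z).2 * (fderiv ℝ f z v).2 := by
  have h := (((hf.hasFDerivAt.fst.pow 2).add (hf.hasFDerivAt.snd.pow 2)).mul_const (2⁻¹ : ℝ))
  have hH : Ham f = fun w => ((f w).1 ^ 2 + (f w).2 ^ 2) * 2⁻¹ := by
    funext w
    simp [Ham, div_eq_mul_inv]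
  rw [hH]
  have h' := h.fderiv
  simp only [Pi.add_apply] at h'
  erw [h']
  simp
  ring

/-- The differential of `f` maps the Hamiltonian field to a multiple of the rotation field. -/
theorem fderiv_apply_hamVF (hf : DifferentiableAt ℝ f z) :
    fderiv ℝ f z (hamVF f z) = jacDet f z • (-(f z).2, (f z).1) := by
  rw [fderiv_apply_eq, jacDet_eq hf]
  simp only [hamVF, pdx, pdy, fderiv_Ham_apply hf]
  ext <;> simp <;> ring

theorem exists_hasStrictFDerivAt_equiv (hf : ContDiffAt ℝ 2 f z) (hdet : jacDet f z ≠ 0) :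
    ∃ e : (ℝ × ℝ) ≃L[ℝ] ℝ × ℝ, (e : ℝ × ℝ →L[ℝ] ℝ × ℝ) = fderiv ℝ f z ∧
      HasStrictFDerivAt f (e : ℝ × ℝ →L[ℝ] ℝ × ℝ) z := by
  have hd : DifferentiableAt ℝ f z := hf.differentiableAt (by norm_num)
  have hinj : Function.Injective (fderiv ℝ f z : ℝ × ℝ →ₗ[ℝ] ℝ × ℝ) := by
    rw [injective_iff_map_eq_zero]
    intro v hv
    rw [jacDet_eq hd] at hdet
    rw [ContinuousLinearMap.coe_coe, fderiv_apply_eq] at hv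
    have h1 := congrArg Prod.fst hv
    have h2 := congrArg Prod.snd hv
    simp only [Prod.fst_add, Prod.smul_fst, smul_eq_mul, Prod.fst_zero, Prod.snd_add,
      Prod.smul_snd, Prod.snd_zero] at h1 h2
    ext
    · refine (mul_eq_zero.1 ?_).resolve_right hdet
      linear_combination (fderiv ℝ f z (0, 1)).2 * h1 - (fderiv ℝ f z (0, 1)).1 * h2
    · refine (mul_eq_zero.1 ?_).resolve_right hdet
      linear_combination (fderiv ℝ f z (1, 0)).1 * h2 - (fderiv ℝ f z (1, 0)).2 * h1
  have he : ((LinearEquiv.ofInjectiveEndo _ hinj).toContinuousLinearEquiv :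
      ℝ × ℝ →L[ℝ] ℝ × ℝ) = fderiv ℝ f z := by
    ext <;> rfl
  exact ⟨_, he, by rw [he]; exact hf.hasStrictFDerivAt (by norm_num)⟩

theorem continuousOn_jacDet {U : Set (ℝ × ℝ)} (hU : IsOpen U) (hf : ContDiffOn ℝ 2 f U) :
    ContinuousOn (jacDet f) U := by
  have hL : ContinuousOn (fderiv ℝ f) U := hf.continuousOn_fderiv_of_isOpen hU (by norm_num)
  have h1 := hL.clm_apply (continuousOn_const (c := ((1, 0) : ℝ × ℝ)))
  have h2 := hL.clm_apply (continuousOn_const (c := ((0, 1) : ℝ × ℝ)))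
  refine ((h1.fst.mul h2.snd).sub (h1.snd.mul h2.fst)).congr fun z hz => ?_
  exact jacDet_eq ((hf.contDiffAt (hU.mem_nhds hz)).differentiableAt (by norm_num))

theorem isLocalHomeomorph_domRestrict {U : Set (ℝ × ℝ)} (hU : IsOpen U)
    (hf : ContDiffOn ℝ 2 f U) (hdet : ∀ z ∈ U, jacDet f z ≠ 0) :
    IsLocalHomeomorph (U.domRestrict f) := by
  have h : IsLocalHomeomorphOn f U := by
    intro z hz
    obtain ⟨e, -, he⟩ := exists_hasStrictFDerivAt_equiv (hf.contDiffAt (hU.mem_nhds hz))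
      (hdet z hz)
    exact ⟨he.toOpenPartialHomeomorph f, he.mem_toOpenPartialHomeomorph_source, rfl⟩
  rw [isLocalHomeomorph_iff_isLocalHomeomorphOn_univ]
  exact h.comp hU.isOpenEmbedding_subtypeVal.isLocalHomeomorph.isLocalHomeomorphOn
    fun x _ => x.2

end Jacobian

section Angle

open MeasureTheory

variable {d : ℝ → ℝ}

theorem hasStrictDerivAt_primitive (hd : Continuous d) (t : ℝ) :
    HasStrictDerivAt (fun t => ∫ s in (0 : ℝ)..t, d s) (d t) t :=
  intervalIntegral.integral_hasStrictDerivAt_right (hd.intervalIntegrable _ _)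
    hd.aestronglyMeasurable.stronglyMeasurableAtFilter hd.continuousAt

theorem primitive_injective (hd : Continuous d) (hd0 : ∀ t, d t ≠ 0) :
    Function.Injective fun t => ∫ s in (0 : ℝ)..t, d s := by
  have hder := hasStrictDerivAt_primitive hd
  have key : ∀ a b : ℝ, a < b →
      (∫ s in (0 : ℝ)..a, d s) ≠ ∫ s in (0 : ℝ)..b, d s := by
    intro a b hab heq
    obtain ⟨c, -, hc⟩ := exists_hasDerivAt_eq_zero hab
      (fun t _ => (hder t).hasDerivAt.continuousAt.continuousWithinAt) heq
      (fun t _ => (hder t).hasDerivAt)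
    exact hd0 c hc
  intro a b hab
  by_contra hne
  rcases lt_or_gt_of_ne hne with h | h
  · exact key a b h hab
  · exact key b a h hab.symm

theorem primitive_add_period (hd : Continuous d) {P : ℝ} (hP : Function.Periodic d P) (t : ℝ) :
    ∫ s in (0 : ℝ)..(t + P), d s = (∫ s in (0 : ℝ)..t, d s) + ∫ s in (0 : ℝ)..P, d s := by
  rw [← intervalIntegral.integral_add_adjacent_intervals (hd.intervalIntegrable 0 t)
    (hd.intervalIntegrable t (t + P)), hP.intervalIntegral_add_eq t 0, zero_add]

theorem primitive_surjective (hd : Continuous d) (hd0 : ∀ t, d t ≠ 0) {P : ℝ} (hP0 : P ≠ 0)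
    (hP : Function.Periodic d P) :
    Function.Surjective fun t => ∫ s in (0 : ℝ)..t, d s := by
  set Θ : ℝ → ℝ := fun t => ∫ s in (0 : ℝ)..t, d s with hΘ
  have hcont : Continuous Θ :=
    continuous_iff_continuousAt.2 fun t => (hasStrictDerivAt_primitive hd t).hasDerivAt.continuousAt
  have h0 : Θ 0 = 0 := intervalIntegral.integral_same
  have hne : Θ P ≠ 0 := fun h => hP0 (primitive_injective hd hd0 (h.trans h0.symm))
  have hadd : ∀ t, Θ (t + P) = Θ t + Θ P := primitive_add_period hd hP
  have hpos : ∀ n : ℕ, Θ (n * P) = n * Θ P := by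
    intro n
    induction n with
    | zero => simp [h0]
    | succ n ih => push_cast; rw [add_mul, one_mul, hadd, ih]; ring
  have hneg : ∀ n : ℕ, Θ (-(n * P)) = -(n * Θ P) := by
    intro n
    induction n with
    | zero => simp [h0]
    | succ n ih =>
      have := hadd (-((n + 1 : ℕ) * P))
      rw [show -(((n + 1 : ℕ) : ℝ) * P) + P = -(n * P) by push_cast; ring, ih] at this
      push_cast at this ⊢
      linarith
  intro y
  obtain ⟨n, hn⟩ := exists_nat_ge (|y| / |Θ P|)
  rw [div_le_iff₀ (abs_pos.2 hne)] at hn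
  have hy := abs_le.1 hn
  have hpre : (range Θ).OrdConnected := (isPreconnected_range hcont).ordConnected
  rcases le_or_gt 0 (Θ P) with h | h
  · rw [abs_of_nonneg h] at hy
    exact hpre.out ⟨_, hneg n⟩ ⟨_, hpos n⟩ ⟨hy.1, hy.2⟩
  · rw [abs_of_neg h] at hy
    exact hpre.out ⟨_, hpos n⟩ ⟨_, hneg n⟩ ⟨by linarith [hy.1], by linarith [hy.2]⟩

/-- An autonomous scalar equation `τ' = ρ ∘ τ` with nowhere vanishing periodic right hand side has
a global bijective solution which is compatible with the period. -/
theorem exists_angle_solution {ρ : ℝ → ℝ} (hρ : Continuous ρ) (hρ0 : ∀ t, ρ t ≠ 0) {P : ℝ}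
    (hP0 : P ≠ 0) (hP : Function.Periodic ρ P) :
    ∃ τ : ℝ → ℝ, τ 0 = 0 ∧ (∀ t, HasDerivAt τ (ρ (τ t)) t) ∧ Function.Surjective τ ∧
      ∃ T > 0, (∀ t, τ (t + T) = τ t + P) ∨ ∀ t, τ (t + T) = τ t - P := by
  set d : ℝ → ℝ := fun t => (ρ t)⁻¹ with hddef
  have hd : Continuous d := hρ.inv₀ hρ0
  have hd0 : ∀ t, d t ≠ 0 := fun t => inv_ne_zero (hρ0 t)
  have hdP : Function.Periodic d P := fun t => by simp only [hddef, hP t]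
  set Θ : ℝ → ℝ := fun t => ∫ s in (0 : ℝ)..t, d s with hΘ
  have hinj : Function.Injective Θ := primitive_injective hd hd0
  have hbij : Function.Bijective Θ := ⟨hinj, primitive_surjective hd hd0 hP0 hdP⟩
  have hder := hasStrictDerivAt_primitive hd
  have hcont : Continuous Θ :=
    continuous_iff_continuousAt.2 fun t => (hder t).hasDerivAt.continuousAt
  set e : ℝ ≃ₜ ℝ := (Equiv.ofBijective Θ hbij).toHomeomorphOfContinuousOpen hcont
    (isOpenMap_of_hasStrictDerivAt hder hd0) with he
  have heΘ : ∀ t, e t = Θ t := fun t => rfl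
  have h0 : Θ 0 = 0 := intervalIntegral.integral_same
  have hΘP : Θ P ≠ 0 := fun h => hP0 (hinj (h.trans h0.symm))
  have hadd : ∀ t, Θ (t + P) = Θ t + Θ P := primitive_add_period hd hdP
  have hsymm : ∀ t, Θ (e.symm t) = t := e.apply_symm_apply
  refine ⟨e.symm, e.symm_apply_eq.2 h0.symm, fun t => ?_, e.symm.surjective, ?_⟩
  · have := HasDerivAt.of_local_left_inverse e.symm.continuous.continuousAt
      (hder (e.symm t)).hasDerivAt (hd0 _) (Filter.Eventually.of_forall hsymm)
    simpa [hddef] using this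
  · rcases lt_or_gt_of_ne hΘP with h | h
    · refine ⟨-Θ P, by linarith, Or.inr fun t => ?_⟩
      rw [e.symm_apply_eq, heΘ]
      have := hadd (e.symm t - P)
      rw [sub_add_cancel, hsymm] at this
      linarith
    · refine ⟨Θ P, h, Or.inl fun t => ?_⟩
      rw [e.symm_apply_eq, heΘ, hadd, hsymm]

/-- A solution of `u' = i d u` rotates around the whole circle through `u 0`, if `d` is periodic
and does not vanish. -/
theorem rotation_solution {u : ℝ → ℂ} (hd : Continuous d) (hd0 : ∀ t, d t ≠ 0) {P : ℝ}
    (hP0 : P ≠ 0) (hP : Function.Periodic d P)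
    (hu : ∀ t, HasDerivAt u (d t * Complex.I * u t) t) :
    (∀ t, ‖u t‖ = ‖u 0‖) ∧ ∀ w, ‖w‖ = ‖u 0‖ → ∃ t, u t = w := by
  set Θ : ℝ → ℝ := fun t => ∫ s in (0 : ℝ)..t, d s with hΘ
  have h0 : Θ 0 = 0 := intervalIntegral.integral_same
  have hΘd : ∀ t, HasDerivAt (fun t => (Θ t : ℂ)) (d t) t :=
    fun t => (hasStrictDerivAt_primitive hd t).hasDerivAt.ofReal_comp
  set v : ℝ → ℂ := fun t => u t * Complex.exp (-(Θ t * Complex.I)) with hv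
  have hvd : ∀ t, HasDerivAt v 0 t := by
    intro t
    have := (hu t).mul (((hΘd t).mul_const Complex.I).neg.cexp)
    exact this.congr_deriv (by ring)
  have hvconst : ∀ t, v t = u 0 := by
    intro t
    rw [is_const_of_deriv_eq_zero (fun t => (hvd t).differentiableAt) (fun t => (hvd t).deriv) t 0]
    simp [hv, h0]
  have hsol : ∀ t, u t = u 0 * Complex.exp (Θ t * Complex.I) := by
    intro t
    rw [← hvconst t, hv, mul_assoc, ← Complex.exp_add]
    simp
  have hnorm : ∀ t, ‖u t‖ = ‖u 0‖ := by
    intro t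
    rw [hsol t, norm_mul, Complex.norm_exp_ofReal_mul_I, mul_one]
  refine ⟨hnorm, fun w hw => ?_⟩
  by_cases hu0 : u 0 = 0
  · refine ⟨0, ?_⟩
    rw [hu0, norm_zero, norm_eq_zero] at hw
    rw [hu0, hw]
  · obtain ⟨t, ht⟩ := primitive_surjective hd hd0 hP0 hP (Complex.arg (w / u 0))
    refine ⟨t, ?_⟩
    have hone : ‖w / u 0‖ = 1 := by
      rw [norm_div, hw, div_self (norm_ne_zero_iff.2 hu0)]
    have := Complex.norm_mul_exp_arg_mul_I (w / u 0)
    rw [hone, Complex.ofReal_one, one_mul] at this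
    rw [hsol t, show Θ t = _ from ht, this, mul_div_cancel₀ _ hu0]

end Angle

section Center

variable {U : Set (ℝ × ℝ)} {f : ℝ × ℝ → ℝ × ℝ}

/-- The real plane identified with the complex plane. -/
noncomputable def planeToComplex : (ℝ × ℝ) ≃L[ℝ] ℂ := Complex.equivRealProdCLM.symm

theorem norm_planeToComplex (w : ℝ × ℝ) : ‖planeToComplex w‖ = euclNorm w := by
  rw [Complex.norm_eq_sqrt_sq_add_sq]
  rfl

theorem planeToComplex_image_disc (r : ℝ) :
    planeToComplex.symm '' Metric.ball 0 r = disc r := by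
  ext w
  rw [ContinuousLinearEquiv.image_symm_eq_preimage, mem_preimage, mem_ball_zero_iff,
    norm_planeToComplex]
  rfl

theorem planeToComplex_rotation (w : ℝ × ℝ) :
    planeToComplex (-w.2, w.1) = Complex.I * planeToComplex w := by
  apply Complex.ext <;> simp [planeToComplex]

/-- Along a solution of the Hamiltonian system, `f` rotates with angular speed `jacDet f`. -/
theorem hasDerivAt_planeToComplex_comp (hU : IsOpen U) (hf : ContDiffOn ℝ 2 f U) {γ : ℝ → ℝ × ℝ}
    {t : ℝ} (hγU : γ t ∈ U) (hγ : HasDerivAt γ (hamVF f (γ t)) t) :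
    HasDerivAt (fun s => planeToComplex (f (γ s)))
      (jacDet f (γ t) * Complex.I * planeToComplex (f (γ t))) t := by
  have hd : DifferentiableAt ℝ f (γ t) :=
    (hf.contDiffAt (hU.mem_nhds hγU)).differentiableAt (by norm_num)
  have h1 := hd.hasFDerivAt.comp_hasDerivAt t hγ
  have h2 := planeToComplex.hasFDerivAt.comp_hasDerivAt t h1
  refine h2.congr_deriv ?_
  rw [fderiv_apply_hamVF hd, ContinuousLinearEquiv.coe_coe, map_smul, planeToComplex_rotation,
    Complex.real_smul, mul_assoc]

theorem injOn_and_image_of_global_center (hUo : IsOpen U) (hUc : IsConnected U)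
    (hf : ContDiffOn ℝ 2 f U) (hdet : ∀ z ∈ U, jacDet f z ≠ 0) {z₀ : ℝ × ℝ} (hz₀ : z₀ ∈ U)
    (hfz : f z₀ = (0, 0))
    (hcenter : ∀ z ∈ U \ {z₀}, ∃ γ, IsPeriodicSolOn (hamVF f) U γ ∧ γ 0 = z) :
    InjOn f U ∧ (f '' U = univ ∨ ∃ r > 0, f '' U = disc r) := by
  have : ConnectedSpace U := isConnected_iff_connectedSpace.1 hUc
  set F : U → ℂ := planeToComplex ∘ U.domRestrict f with hFdef
  have hF : IsLocalHomeomorph F :=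
    planeToComplex.toHomeomorph.isLocalHomeomorph.comp (isLocalHomeomorph_domRestrict hUo hf hdet)
  have hF0 : F ⟨z₀, hz₀⟩ = 0 := by
    change planeToComplex (f z₀) = 0
    rw [hfz]
    exact map_zero planeToComplex
  obtain ⟨hinj, hrange⟩ := injective_and_range_of_sphere_lift hF hF0 (by
    intro p hp
    have hpz : (p : ℝ × ℝ) ∉ ({z₀} : Set (ℝ × ℝ)) := by
      intro h
      exact hp ((congrArg F (Subtype.ext (mem_singleton_iff.1 h))).trans hF0)
    obtain ⟨γ, ⟨hγU, hγ, ⟨T, hT, hper⟩, -⟩, hγ0⟩ := hcenter p ⟨p.2, hpz⟩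
    have hγc : Continuous γ := continuous_iff_continuousAt.2 fun t => (hγ t).continuousAt
    have hrot := rotation_solution (d := fun t => jacDet f (γ t))
      (u := fun t => planeToComplex (f (γ t)))
      ((continuousOn_jacDet hUo hf).comp_continuous hγc hγU) (fun t => hdet _ (hγU t)) hT.ne'
      (fun t => by simp only [hper t])
      (fun t => hasDerivAt_planeToComplex_comp hUo hf (hγU t) (hγ t))
    simp only [hγ0] at hrot
    exact ⟨fun t => ⟨γ t, hγU t⟩, hγc.subtype_mk hγU, Subtype.ext hγ0, hrot.1, hrot.2⟩)
  have himage : f '' U = planeToComplex.symm '' range F := by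
    rw [hFdef, range_comp, range_domRestrict, ← image_comp]
    simp
  refine ⟨injOn_iff_injective.2 hinj.of_comp, ?_⟩
  rw [himage]
  rcases hrange with h | ⟨r, hr, h⟩
  · left
    rw [h, image_univ]
    exact planeToComplex.symm.surjective.range_eq
  · exact Or.inr ⟨r, hr, by rw [h, planeToComplex_image_disc]⟩

/-- A left inverse of `f` on `U` is differentiable on `f '' U`, and its differential sends the
rotation field to a multiple of the Hamiltonian field. -/
theorem exists_hasFDerivAt_leftInverse (hUo : IsOpen U) (hf : ContDiffOn ℝ 2 f U)
    (hdet : ∀ z ∈ U, jacDet f z ≠ 0) {g : ℝ × ℝ → ℝ × ℝ} (hg : ∀ z ∈ U, g (f z) = z)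
    {z : ℝ × ℝ} (hz : z ∈ U) :
    ∃ L : ℝ × ℝ →L[ℝ] ℝ × ℝ, HasFDerivAt g L (f z) ∧
      jacDet f z • L (-(f z).2, (f z).1) = hamVF f z := by
  have hfz := hf.contDiffAt (hUo.mem_nhds hz)
  obtain ⟨e, he, hstrict⟩ := exists_hasStrictFDerivAt_equiv hfz (hdet z hz)
  refine ⟨e.symm, (hstrict.to_local_left_inverse
    (Filter.eventually_of_mem (hUo.mem_nhds hz) hg)).hasFDerivAt, ?_⟩
  rw [← map_smul, ← fderiv_apply_hamVF (hfz.differentiableAt (by norm_num)), ← he]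
  simp

theorem exists_periodicSol_of_injOn (hUo : IsOpen U) (hf : ContDiffOn ℝ 2 f U)
    (hdet : ∀ z ∈ U, jacDet f z ≠ 0) (hinj : InjOn f U)
    (hrot : ∀ w ∈ f '' U, ∀ w', euclNorm w' = euclNorm w → w' ∈ f '' U)
    {z : ℝ × ℝ} (hz : z ∈ U) (hfz : f z ≠ 0) :
    ∃ γ, IsPeriodicSolOn (hamVF f) U γ ∧ γ 0 = z := by
  set g : ℝ × ℝ → ℝ × ℝ := Function.invFunOn f U with hgdef
  have hg : ∀ y ∈ U, g (f y) = y := fun y hy => hinj.leftInvOn_invFunOn hy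
  set a : ℂ := planeToComplex (f z) with ha
  have ha0 : a ≠ 0 := by simpa [ha] using hfz
  set c : ℝ → ℝ × ℝ := fun θ => planeToComplex.symm (a * Complex.exp (θ * Complex.I)) with hc
  have hc0 : c 0 = f z := by simp [hc, ha]
  have hcnorm : ∀ θ, euclNorm (c θ) = euclNorm (f z) := by
    intro θ
    rw [← norm_planeToComplex, ← norm_planeToComplex, hc]
    simp [ha, Complex.norm_exp_ofReal_mul_I]
  have hcU : ∀ θ, c θ ∈ f '' U := fun θ => hrot (f z) (mem_image_of_mem f hz) _ (hcnorm θ)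
  have hgU : ∀ θ, g (c θ) ∈ U := fun θ => Function.invFunOn_mem (hcU θ)
  have hfg : ∀ θ, f (g (c θ)) = c θ := fun θ => Function.invFunOn_eq (hcU θ)
  have hcder : ∀ θ, HasDerivAt c (-(c θ).2, (c θ).1) θ := by
    intro θ
    have h1 : HasDerivAt (fun θ : ℝ => a * Complex.exp (θ * Complex.I))
        (Complex.I * (a * Complex.exp (θ * Complex.I))) θ := by
      have := (((hasDerivAt_id θ).ofReal_comp.mul_const Complex.I).cexp).const_mul a
      refine this.congr_deriv ?_
      simp
      ring
    have h2 := planeToComplex.symm.hasFDerivAt.comp_hasDerivAt θ h1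
    refine h2.congr_deriv ?_
    rw [ContinuousLinearEquiv.coe_coe, ContinuousLinearEquiv.symm_apply_eq,
      planeToComplex_rotation]
    simp [hc]
  have hcper : Function.Periodic c (2 * π) := by
    intro θ
    simp only [hc]
    push_cast
    rw [add_mul, Complex.exp_add, Complex.exp_two_pi_mul_I, mul_one]
  have hgc : ∀ θ, ∃ v, HasDerivAt (fun θ => g (c θ)) v θ ∧
      jacDet f (g (c θ)) • v = hamVF f (g (c θ)) := by
    intro θ
    obtain ⟨L, hL, hLv⟩ := exists_hasFDerivAt_leftInverse hUo hf hdet hg (hgU θ)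
    rw [hfg] at hL hLv
    exact ⟨_, hL.comp_hasDerivAt θ (hcder θ), hLv⟩
  have hgcc : Continuous fun θ => g (c θ) := continuous_iff_continuousAt.2 fun θ =>
    (hgc θ).choose_spec.1.continuousAt
  obtain ⟨τ, hτ0, hτ, hτs, T, hT, hτT⟩ := exists_angle_solution
    (ρ := fun θ => jacDet f (g (c θ))) ((continuousOn_jacDet hUo hf).comp_continuous hgcc hgU)
    (fun θ => hdet _ (hgU θ)) Real.two_pi_pos.ne' (fun θ => by simp only [hcper θ])
  refine ⟨fun t => g (c (τ t)), ⟨fun t => hgU _, fun t => ?_, ⟨T, hT, fun t => ?_⟩, ?_⟩, ?_⟩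
  · obtain ⟨v, hv, hvX⟩ := hgc (τ t)
    rw [← hvX]
    exact hv.scomp t (hτ t)
  · rcases hτT with h | h
    · simp only [h t, hcper (τ t)]
    · simp only [h t, hcper.sub_eq (τ t)]
  · obtain ⟨s, hs⟩ := hτs π
    refine ⟨0, s, fun h => ?_⟩
    have h' := congrArg f h
    simp only [hfg, hτ0, hs] at h'
    have h'' := planeToComplex.symm.injective h'
    simp only [Complex.ofReal_zero, zero_mul, Complex.exp_zero, Complex.exp_pi_mul_I] at h''
    have h2 : (2 : ℂ) * a = 0 := by linear_combination h''
    exact ha0 ((mul_eq_zero.1 h2).resolve_left two_ne_zero)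
  · simp only [hτ0, hc0, hg z hz]

end Center

theorem global_center_iff_injective_and_image (U : Set (ℝ × ℝ)) (hUo : IsOpen U)
    (hUc : IsConnected U) (f : ℝ × ℝ → ℝ × ℝ) (hf : ContDiffOn ℝ 2 f U)
    (hdet : ∀ z ∈ U, jacDet f z ≠ 0)
    (z₀ : ℝ × ℝ) (hz₀ : z₀ ∈ U) (hfz : f z₀ = (0, 0)) :
    (∀ z ∈ U \ {z₀}, ∃ γ, IsPeriodicSolOn (hamVF f) U γ ∧ γ 0 = z) ↔
      Set.InjOn f U ∧ (f '' U = Set.univ ∨ ∃ r > 0, f '' U = disc r) := by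
  refine ⟨injOn_and_image_of_global_center hUo hUc hf hdet hz₀ hfz, ?_⟩
  rintro ⟨hinj, himage⟩ z ⟨hz, hne⟩
  refine exists_periodicSol_of_injOn hUo hf hdet hinj ?_ hz
    fun h => hne (hinj hz hz₀ (h.trans hfz.symm))
  intro w hw w' hww
  rcases himage with h | ⟨r, -, h⟩
  · rw [h]
    exact mem_univ w'
  · rw [h] at hw ⊢
    exact hww.trans_lt hw
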